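/- Let T be a tree on the vertex set {1,…,n} with n ≥ 2. Then the number of distinct permutations arising as products of edge orderings of T satisfies |C(T)| ≥ 2^{n−2}, with equality if and only if T is a path (a tree all of whose vertices have degree at most 2). (Corollary 2.4(b).) -/

import Mathlib

/-- The transposition of `Sₙ` corresponding to an edge (an unordered pair) of a graph
on the vertex set `Fin n`. -/
def edgePerm {n : ℕ} (e : Sym2 (Fin n)) : Equiv.Perm (Fin n) :=
  Sym2.lift ⟨fun i j => Equiv.swap i j, fun i j => Equiv.swap_comm i j⟩ e

/-- The product of the transpositions of a list of edges, the first edge applied first. -/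
def listProd {n : ℕ} (l : List (Sym2 (Fin n))) : Equiv.Perm (Fin n) :=
  (l.map edgePerm).reverse.prod

/-- `l` is an edge ordering of the graph `T`: a duplicate-free list containing
exactly the edges of `T`. -/
def IsEdgeOrdering {n : ℕ} (T : SimpleGraph (Fin n)) (l : List (Sym2 (Fin n))) : Prop :=
  l.Nodup ∧ ∀ e, e ∈ l ↔ e ∈ T.edgeSet

open SimpleGraph Equiv

section Products

variable {n : ℕ}

theorem edgePerm_mk (i j : Fin n) : edgePerm s(i, j) = swap i j := rfl

theorem edgePerm_inv (e : Sym2 (Fin n)) : (edgePerm e)⁻¹ = edgePerm e := by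
  induction e with | _ i j => simp [edgePerm_mk]

theorem edgePerm_apply_of_notMem {e : Sym2 (Fin n)} {x : Fin n} (h : x ∉ e) :
    edgePerm e x = x := by
  induction e with
  | _ i j =>
    simp only [Sym2.mem_iff, not_or] at h
    exact swap_apply_of_ne_of_ne h.1 h.2

theorem listProd_nil : listProd ([] : List (Sym2 (Fin n))) = 1 := rfl

theorem listProd_cons (e : Sym2 (Fin n)) (l : List (Sym2 (Fin n))) :
    listProd (e :: l) = listProd l * edgePerm e := by
  simp [listProd]

theorem listProd_append (l₁ l₂ : List (Sym2 (Fin n))) :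
    listProd (l₁ ++ l₂) = listProd l₂ * listProd l₁ := by
  simp [listProd]

theorem listProd_apply_of_forall_notMem {l : List (Sym2 (Fin n))} {x : Fin n}
    (h : ∀ e ∈ l, x ∉ e) : listProd l x = x := by
  induction l with
  | nil => rfl
  | cons e l ih =>
    rw [listProd_cons, Perm.mul_apply, edgePerm_apply_of_notMem (h e (by simp)),
      ih fun f hf => h f (by simp [hf])]

theorem listProd_concat_inv_apply (l : List (Sym2 (Fin n))) (e : Sym2 (Fin n)) (x : Fin n) :
    (listProd (l ++ [e]))⁻¹ x = (listProd l)⁻¹ (edgePerm e x) := by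
  rw [listProd_append, listProd_cons, listProd_nil, one_mul, mul_inv_rev, edgePerm_inv,
    Perm.mul_apply]

theorem reachable_listProd_inv (l : List (Sym2 (Fin n))) (x : Fin n) :
    (fromEdgeSet {e | e ∈ l}).Reachable x ((listProd l)⁻¹ x) := by
  induction l using List.reverseRecOn generalizing x with
  | nil => simp [listProd_nil]
  | append_singleton l e ih =>
    rw [listProd_concat_inv_apply]
    refine Reachable.trans ?_ ((ih (edgePerm e x)).mono
      (fromEdgeSet_mono fun f hf => by simp_all))
    by_cases hx : x ∈ e
    · obtain ⟨y, rfl⟩ := hx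
      rw [edgePerm_mk, swap_apply_left]
      by_cases hxy : x = y
      · rw [hxy]
      · exact Adj.reachable (by simp [hxy])
    · rw [edgePerm_apply_of_notMem hx]

/-- Inserting the edge `s(u, v)` into a list of edges avoiding `v` multiplies the product by a
transposition moving `v`. -/
theorem listProd_insert {l₁ : List (Sym2 (Fin n))} {v : Fin n} (h : ∀ e ∈ l₁, v ∉ e)
    (l₂ : List (Sym2 (Fin n))) (u : Fin n) :
    listProd (l₁ ++ s(u, v) :: l₂) =
      listProd (l₁ ++ l₂) * swap ((listProd l₁)⁻¹ u) v := by
  have hv : (listProd l₁)⁻¹ v = v := by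
    rw [Perm.inv_eq_iff_eq, listProd_apply_of_forall_notMem h]
  rw [listProd_append, listProd_append, listProd_cons, edgePerm_mk, mul_assoc, mul_assoc,
    swap_mul_eq_mul_swap, hv]

/-- The positions taken by `u` under the inverses of the products of the prefixes of `l`. -/
def prefixTrace (l : List (Sym2 (Fin n))) (u : Fin n) : Finset (Fin n) :=
  (l.inits.map fun l₁ => (listProd l₁)⁻¹ u).toFinset

theorem mem_prefixTrace {l : List (Sym2 (Fin n))} {u w : Fin n} :
    w ∈ prefixTrace l u ↔ ∃ l₁, l₁ <+: l ∧ (listProd l₁)⁻¹ u = w := by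
  simp [prefixTrace]

theorem prefixTrace_concat (l : List (Sym2 (Fin n))) (e : Sym2 (Fin n)) (u : Fin n) :
    prefixTrace (l ++ [e]) u = insert ((listProd l)⁻¹ (edgePerm e u)) (prefixTrace l u) := by
  ext w
  simp only [mem_prefixTrace, List.prefix_concat_iff, Finset.mem_insert, or_and_right, exists_or,
    exists_eq_left, listProd_concat_inv_apply, eq_comm]

theorem card_prefixTrace {G : SimpleGraph (Fin n)} (hG : G.IsAcyclic) {l : List (Sym2 (Fin n))}
    (hl : l.Nodup) (hlG : ∀ e ∈ l, e ∈ G.edgeSet) (u : Fin n) :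
    (prefixTrace l u).card = l.countP (u ∈ ·) + 1 := by
  induction l using List.reverseRecOn with
  | nil => simp [prefixTrace]
  | append_singleton l e ih =>
    have hnd : l.Nodup := hl.of_append_left
    have hel : e ∉ l := by
      intro h
      simpa using List.disjoint_of_nodup_append hl h
    have ih := ih hnd fun f hf => hlG f (by simp [hf])
    rw [prefixTrace_concat, List.countP_append]
    by_cases hu : u ∈ e
    · obtain ⟨x, rfl⟩ := hu
      rw [edgePerm_mk, swap_apply_left, Finset.card_insert_of_notMem, ih]
      · simp
      · intro hmem
        obtain ⟨l₁, hl₁, h⟩ := mem_prefixTrace.1 hmem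
        have h₁ := (reachable_listProd_inv l₁ u).mono
          (fromEdgeSet_mono (t := {e | e ∈ l}) fun f hf => hl₁.subset hf)
        have h₂ := reachable_listProd_inv l x
        rw [h] at h₁
        refine isBridge_iff.1 (isAcyclic_iff_forall_isBridge.1 hG (hlG s(u, x) (by simp)))
          ((h₁.trans h₂.symm).mono ?_)
        intro a b hab
        rw [fromEdgeSet_adj] at hab
        rw [deleteEdges_adj]
        refine ⟨hlG s(a, b) (by simp [show s(a, b) ∈ l from hab.1]), ?_⟩
        rintro (h : s(a, b) = s(u, x))
        exact hel (h ▸ hab.1)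
    · rw [edgePerm_apply_of_notMem hu, Finset.insert_eq_of_mem, ih]
      · simp [hu]
      · exact mem_prefixTrace.2 ⟨l, List.prefix_rfl, rfl⟩

theorem prefix_inv_apply_eq {l : List (Sym2 (Fin n))} {u : Fin n} (h : l.countP (u ∈ ·) ≤ 1)
    {l₁ : List (Sym2 (Fin n))} (hl₁ : l₁ <+: l) :
    (listProd l₁)⁻¹ u = u ∨ (listProd l₁)⁻¹ u = (listProd l)⁻¹ u := by
  obtain ⟨l₂, rfl⟩ := hl₁
  rw [List.countP_append] at h
  obtain h | h : l₁.countP (u ∈ ·) = 0 ∨ l₂.countP (u ∈ ·) = 0 := by omega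
  all_goals
    rw [List.countP_eq_zero] at h
    have h := listProd_apply_of_forall_notMem (by simpa using h)
  · exact .inl (by rw [Perm.inv_eq_iff_eq, h])
  · refine .inr ?_
    rw [listProd_append, mul_inv_rev, Perm.mul_apply]
    congr 1
    rw [Perm.eq_inv_iff_eq, h]

end Products

section Counting

variable {n : ℕ}

/-- The set of products of edge orderings of a graph. -/
def edgeProducts (G : SimpleGraph (Fin n)) : Set (Perm (Fin n)) :=
  {c | ∃ l, IsEdgeOrdering G l ∧ listProd l = c}

theorem isEdgeOrdering_insert_iff {G : SimpleGraph (Fin n)} {e : Sym2 (Fin n)} (he : e ∈ G.edgeSet)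
    (l₁ l₂ : List (Sym2 (Fin n))) :
    IsEdgeOrdering G (l₁ ++ e :: l₂) ↔ IsEdgeOrdering (G.deleteEdges {e}) (l₁ ++ l₂) := by
  simp only [IsEdgeOrdering, List.nodup_middle, List.nodup_cons, edgeSet_deleteEdges,
    Set.mem_sdiff, Set.mem_singleton_iff]
  constructor
  · rintro ⟨⟨h₁, h₂⟩, h₃⟩
    refine ⟨h₂, fun f => ?_⟩
    rw [← h₃ f]
    by_cases hf : f = e
    · simp [hf, h₁]
    · simp [hf]
  · rintro ⟨h₂, h₃⟩
    refine ⟨⟨by simp [h₃ e], h₂⟩, fun f => ?_⟩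
    by_cases hf : f = e
    · simp [hf, he]
    · have := h₃ f
      simp_all

theorem IsEdgeOrdering.countP_eq_degree {G : SimpleGraph (Fin n)} [DecidableRel G.Adj]
    {l : List (Sym2 (Fin n))} (h : IsEdgeOrdering G l) (u : Fin n) :
    l.countP (u ∈ ·) = G.degree u := by
  rw [← card_incidenceFinset_eq_degree, List.countP_eq_length_filter,
    ← List.toFinset_card_of_nodup (h.1.filter _)]
  congr 1
  ext e
  simp [h.2 e, mem_incidenceFinset, incidenceSet]

theorem mul_swap_eq_mul_swap_iff {c c' : Perm (Fin n)} {w w' v : Fin n} (hc : c v = v)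
    (hc' : c' v = v) : c * swap w v = c' * swap w' v ↔ c = c' ∧ w = w' := by
  refine ⟨fun h => ?_, fun ⟨h₁, h₂⟩ => by rw [h₁, h₂]⟩
  have hw : w = w' := by
    have := congrArg (fun σ : Perm (Fin n) => σ⁻¹ v) h
    simpa [c.symm_apply_eq.2 hc.symm, c'.symm_apply_eq.2 hc'.symm] using this
  subst hw
  exact ⟨mul_right_cancel h, rfl⟩

variable {G : SimpleGraph (Fin n)} {u v : Fin n}

theorem IsEdgeOrdering.notMem_of_leaf (hv : ∀ w, G.Adj v w ↔ w = u) {l : List (Sym2 (Fin n))}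
    (h : IsEdgeOrdering (G.deleteEdges {s(u, v)}) l) : ∀ e ∈ l, v ∉ e := by
  rintro _ he ⟨w, rfl⟩
  have := (h.2 _).1 he
  simp only [edgeSet_deleteEdges, Set.mem_sdiff, mem_edgeSet, hv, Set.mem_singleton_iff] at this
  exact this.2 (by rw [this.1, Sym2.eq_swap])

theorem apply_eq_of_mem_edgeProducts (hv : ∀ w, G.Adj v w ↔ w = u) {c : Perm (Fin n)}
    (hc : c ∈ edgeProducts (G.deleteEdges {s(u, v)})) : c v = v := by
  obtain ⟨l, hl, rfl⟩ := hc
  exact listProd_apply_of_forall_notMem (hl.notMem_of_leaf hv)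

theorem mem_edgeProducts_iff (hv : ∀ w, G.Adj v w ↔ w = u) {c : Perm (Fin n)} :
    c ∈ edgeProducts G ↔ ∃ l, IsEdgeOrdering (G.deleteEdges {s(u, v)}) l ∧
      ∃ w ∈ prefixTrace l u, listProd l * swap w v = c := by
  have he : s(u, v) ∈ G.edgeSet := ((hv u).2 rfl).symm
  constructor
  · rintro ⟨l, hl, rfl⟩
    obtain ⟨l₁, l₂, rfl⟩ := List.append_of_mem ((hl.2 _).2 he)
    have hl' := (isEdgeOrdering_insert_iff he l₁ l₂).1 hl
    refine ⟨l₁ ++ l₂, hl', _, mem_prefixTrace.2 ⟨l₁, List.prefix_append _ _, rfl⟩, ?_⟩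
    rw [listProd_insert fun e h => hl'.notMem_of_leaf hv e (by simp [h])]
  · rintro ⟨_, hl, w, hw, rfl⟩
    obtain ⟨l₁, ⟨l₂, rfl⟩, rfl⟩ := mem_prefixTrace.1 hw
    refine ⟨_, (isEdgeOrdering_insert_iff he l₁ l₂).2 hl, ?_⟩
    rw [listProd_insert fun e h => hl.notMem_of_leaf hv e (by simp [h])]

theorem neighborFinset_eq_insert_of_leaf [DecidableRel G.Adj]
    [DecidableRel (G.deleteEdges {s(u, v)}).Adj] (huv : G.Adj u v) :
    G.neighborFinset u = insert v ((G.deleteEdges {s(u, v)}).neighborFinset u) := by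
  ext w
  by_cases hw : w = v <;> simp [hw, huv, huv.ne]

theorem degree_deleteEdges_add_one [DecidableRel G.Adj]
    [DecidableRel (G.deleteEdges {s(u, v)}).Adj] (huv : G.Adj u v) :
    (G.deleteEdges {s(u, v)}).degree u + 1 = G.degree u := by
  rw [← card_neighborFinset_eq_degree, ← card_neighborFinset_eq_degree,
    neighborFinset_eq_insert_of_leaf huv, Finset.card_insert_of_notMem (by simp)]

theorem degree_deleteEdges_of_ne [DecidableRel G.Adj]
    [DecidableRel (G.deleteEdges {s(u, v)}).Adj] {w : Fin n} (hu : w ≠ u) (hv : w ≠ v) :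
    (G.deleteEdges {s(u, v)}).degree w = G.degree w := by
  rw [← card_neighborFinset_eq_degree, ← card_neighborFinset_eq_degree]
  congr 1
  ext x
  simp [hu, hv]

theorem degree_mul_ncard_edgeProducts_le [DecidableRel G.Adj] (hG : G.IsAcyclic)
    (hv : ∀ w, G.Adj v w ↔ w = u) :
    G.degree u * (edgeProducts (G.deleteEdges {s(u, v)})).ncard ≤ (edgeProducts G).ncard := by
  classical
  have huv : G.Adj u v := ((hv u).2 rfl).symm
  choose! f hf hfc using fun c (hc : c ∈ edgeProducts (G.deleteEdges {s(u, v)})) => hc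
  set S := (edgeProducts (G.deleteEdges {s(u, v)})).toFinset
  have hcard : (S.sigma fun c => prefixTrace (f c) u).card = S.card * G.degree u := by
    rw [Finset.card_sigma, Finset.sum_const_nat]
    intro c hc
    have hl := hf c (Set.mem_toFinset.1 hc)
    rw [card_prefixTrace (hG.anti (deleteEdges_le _)) hl.1 (fun e => (hl.2 e).1),
      hl.countP_eq_degree, degree_deleteEdges_add_one huv]
  rw [Set.ncard_eq_toFinset_card', Set.ncard_eq_toFinset_card', mul_comm, ← hcard]
  refine Finset.card_le_card_of_injOn (fun p => p.1 * swap p.2 v) ?_ ?_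
  · rintro ⟨c, w⟩ hp
    obtain ⟨hc, hw⟩ := Finset.mem_sigma.1 hp
    have hc := Set.mem_toFinset.1 hc
    rw [Finset.mem_coe, Set.mem_toFinset, mem_edgeProducts_iff hv]
    exact ⟨f c, hf c hc, w, hw, by rw [hfc c hc]⟩
  · rintro ⟨c, w⟩ hp ⟨c', w'⟩ hp' h
    have hc := Set.mem_toFinset.1 (Finset.mem_sigma.1 hp).1
    have hc' := Set.mem_toFinset.1 (Finset.mem_sigma.1 hp').1
    obtain ⟨rfl, rfl⟩ := (mul_swap_eq_mul_swap_iff (apply_eq_of_mem_edgeProducts hv hc)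
      (apply_eq_of_mem_edgeProducts hv hc')).1 h
    rfl

theorem ncard_edgeProducts_le_degree_mul [DecidableRel G.Adj] (hv : ∀ w, G.Adj v w ↔ w = u)
    (hu : G.degree u ≤ 2) :
    (edgeProducts G).ncard ≤ G.degree u * (edgeProducts (G.deleteEdges {s(u, v)})).ncard := by
  classical
  have huv : G.Adj u v := ((hv u).2 rfl).symm
  have hdeg := degree_deleteEdges_add_one huv
  set S := (edgeProducts (G.deleteEdges {s(u, v)})).toFinset
  have hsub : (edgeProducts G).toFinset ⊆
      S.biUnion fun c => ({u, c⁻¹ u} : Finset (Fin n)).image fun w => c * swap w v := by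
    intro c hc
    obtain ⟨l, hl, w, hw, rfl⟩ := (mem_edgeProducts_iff hv).1 (Set.mem_toFinset.1 hc)
    obtain ⟨l₁, hl₁, rfl⟩ := mem_prefixTrace.1 hw
    refine Finset.mem_biUnion.2 ⟨listProd l, Set.mem_toFinset.2 ⟨l, hl, rfl⟩,
      Finset.mem_image.2 ⟨_, ?_, rfl⟩⟩
    simpa using prefix_inv_apply_eq (by rw [hl.countP_eq_degree]; omega) hl₁
  rw [Set.ncard_eq_toFinset_card', Set.ncard_eq_toFinset_card', mul_comm]
  refine (Finset.card_le_card hsub).trans (Finset.card_biUnion_le_card_mul _ _ _ fun c hc => ?_)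
  refine Finset.card_image_le.trans ?_
  obtain h | h : G.degree u = 1 ∨ G.degree u = 2 := by omega
  · obtain ⟨l, hl, rfl⟩ := Set.mem_toFinset.1 hc
    have h₀ : l.countP (u ∈ ·) = 0 := by rw [hl.countP_eq_degree]; omega
    rw [List.countP_eq_zero] at h₀
    have h₁ := listProd_apply_of_forall_notMem (by simpa using h₀)
    rw [Perm.inv_eq_iff_eq.2 h₁.symm, h]
    simp
  · rw [h]
    exact Finset.card_le_two

theorem SimpleGraph.IsAcyclic.exists_leaf (hG : G.IsAcyclic) (h : G ≠ ⊥) :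
    ∃ u v, ∀ w, G.Adj v w ↔ w = u := by
  obtain ⟨a, b, hab⟩ := ne_bot_iff_exists_adj.1 h
  have : Nonempty (Fin n) := ⟨a⟩
  obtain ⟨u, v, p, hp, hmax⟩ := Walk.exists_isPath_forall_isPath_length_le_length G
  have hnil : ¬p.Nil := by
    have := hmax _ _ _ (Path.singleton hab).2
    rw [← Walk.length_eq_zero_iff]
    simp [Path.singleton] at this
    omega
  refine ⟨p.snd, u, fun w => ⟨fun hadj => ?_, fun hw => hw ▸ p.adj_snd hnil⟩⟩
  apply hG.eq_snd_of_adj_start hp hadj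
  have : ¬(p.cons hadj.symm).IsPath := by grind [Walk.length_cons]
  grind [hp.cons]

theorem two_pow_le_ncard_edgeProducts (G : SimpleGraph (Fin n)) [DecidableRel G.Adj]
    (hG : G.IsAcyclic) :
    2 ^ (∑ v, (G.degree v - 1)) ≤ (edgeProducts G).ncard ∧
      ((edgeProducts G).ncard = 2 ^ (∑ v, (G.degree v - 1)) ↔ ∀ v, G.degree v ≤ 2) := by
  classical
  induction hm : G.edgeFinset.card using Nat.strong_induction_on generalizing G with
  | _ m ih =>
  by_cases hbot : G = ⊥
  · subst hbot
    have : edgeProducts (⊥ : SimpleGraph (Fin n)) = {1} := by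
      ext c
      simp only [edgeProducts, IsEdgeOrdering, edgeSet_bot, Set.mem_empty_iff_false, iff_false,
        ← List.eq_nil_iff_forall_not_mem, Set.mem_ofPred_eq, Set.mem_singleton_iff]
      constructor
      · rintro ⟨_, ⟨-, rfl⟩, rfl⟩
        rfl
      · rintro rfl
        exact ⟨[], ⟨List.nodup_nil, rfl⟩, rfl⟩
    simp [this]
  obtain ⟨u, v, hv⟩ := hG.exists_leaf hbot
  have huv : G.Adj u v := ((hv u).2 rfl).symm
  have hlow := degree_mul_ncard_edgeProducts_le hG hv
  have hup := ncard_edgeProducts_le_degree_mul hv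
  have hdu := degree_deleteEdges_add_one huv
  have hdw := fun w => degree_deleteEdges_of_ne (G := G) (u := u) (v := v) (w := w)
  have hdv : G.degree v = 1 :=
    degree_eq_one_iff_existsUnique_adj.2 ⟨u, (hv u).2 rfl, fun w hw => (hv w).1 hw⟩
  have hdv' : (G.deleteEdges {s(u, v)}).degree v + 1 = G.degree v := by
    have := degree_deleteEdges_add_one huv.symm
    convert this using 5; exact Sym2.eq_swap
  obtain ⟨ih₁, ih₂⟩ := ih _ (by
    rw [← hm]
    refine Finset.card_lt_card (edgeFinset_ssubset_edgeFinset.2 ?_)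
    refine (deleteEdges_le _).lt_of_ne fun h => ?_
    have := h ▸ huv
    simp at this) (G.deleteEdges {s(u, v)}) (hG.anti (deleteEdges_le _)) rfl
  have hsum : ∑ w, (G.degree w - 1) =
      ∑ w, ((G.deleteEdges {s(u, v)}).degree w - 1) + (if G.degree u = 1 then 0 else 1) := by
    rw [← Finset.add_sum_erase _ _ (Finset.mem_univ u),
      ← Finset.add_sum_erase _ _ (Finset.mem_univ u)]
    have : ∑ w ∈ Finset.univ.erase u, (G.degree w - 1) =
        ∑ w ∈ Finset.univ.erase u, ((G.deleteEdges {s(u, v)}).degree w - 1) := by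
      refine Finset.sum_congr rfl fun w hw => ?_
      by_cases hwv : w = v
      · subst hwv; omega
      · rw [hdw w (Finset.ne_of_mem_erase hw) hwv]
    rw [this]
    split_ifs <;> omega
  have hdeg : (∀ w, G.degree w ≤ 2) ↔
      G.degree u ≤ 2 ∧ ∀ w, (G.deleteEdges {s(u, v)}).degree w ≤ 2 := by
    refine ⟨fun h => ⟨h u, fun w => ?_⟩, fun h w => ?_⟩
    · have := h w
      grind
    · have := h.2 w
      grind
  generalize ∑ w, (G.degree w - 1) = a at *
  generalize ∑ w, ((G.deleteEdges {s(u, v)}).degree w - 1) = b at *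
  generalize (edgeProducts G).ncard = N at *
  generalize (edgeProducts (G.deleteEdges {s(u, v)})).ncard = N' at *
  rw [hdeg, ← ih₂]
  have hpos : 0 < 2 ^ b := by positivity
  obtain h | h | h : G.degree u = 1 ∨ G.degree u = 2 ∨ 3 ≤ G.degree u := by omega
  · rw [h, one_mul] at hlow hup
    have := hup (by omega)
    rw [hsum, if_pos h, add_zero]
    omega
  · rw [h] at hlow hup
    have := hup le_rfl
    rw [hsum, if_neg (by omega), pow_succ]
    omega
  · have : G.degree u ≠ 1 := by omega
    rw [hsum, if_neg this, pow_succ]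
    have : 3 * N' ≤ G.degree u * N' := Nat.mul_le_mul_right _ h
    omega

end Counting

/-- Corollary 2.4(b): the number of distinct permutations arising as
products of edge orderings of a tree on `n ≥ 2` vertices is at least `2^(n-2)`, with
equality iff the tree is a path (all degrees at most 2). -/
theorem stmt4 (n : ℕ) (hn : 2 ≤ n) (T : SimpleGraph (Fin n)) [DecidableRel T.Adj]
    (hT : T.IsTree) :
    2 ^ (n - 2) ≤ {c : Equiv.Perm (Fin n) | ∃ l, IsEdgeOrdering T l ∧ listProd l = c}.ncard ∧
    ({c : Equiv.Perm (Fin n) | ∃ l, IsEdgeOrdering T l ∧ listProd l = c}.ncard = 2 ^ (n - 2)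
      ↔ ∀ v : Fin n, T.degree v ≤ 2) := by
  have hle := two_pow_le_ncard_edgeProducts T hT.isAcyclic
  have hsum : ∑ v, (T.degree v - 1) = n - 2 := by
    have : Nontrivial (Fin n) := Fin.nontrivial_iff_two_le.2 hn
    have hadd : ∑ v, (T.degree v - 1) + n = ∑ v, T.degree v := by
      rw [← Finset.sum_congr rfl fun v _ => Nat.sub_add_cancel
        (hT.connected.preconnected.degree_pos_of_nontrivial v), Finset.sum_add_distrib]
      simp
    have hdeg := T.sum_degrees_eq_twice_card_edges
    have hcard := hT.card_edgeFinset
    rw [Fintype.card_fin] at hcard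
    omega
  rw [hsum] at hle
  exact hle
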